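/- arXiv:1701.07106 — 9 statements merged into one kernel-verified Lean document; each statement's English description precedes it below -/
import Mathlib

section
/- In a system satisfying Restricted Case I, for any two entities e_i and e_j, the kill sets KillSet({e_i}) and KillSet({e_j}) satisfy exactly one of: KillSet({e_i}) ∩ KillSet({e_j}) = ∅, or KillSet({e_i}) ∩ KillSet({e_j}) = KillSet({e_i}), or KillSet({e_i}) ∩ KillSet({e_j}) = KillSet({e_j}); that is, the two kill sets are either disjoint or one is contained in the other. -/
open Finset

/-- An Implicative Interdependency Model (IIM) system on a finite entity set `α`.
`idr e` is the (finite) set of minterms of the IDR of entity `e`;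
`idr e = ∅` means that `e` has no IDR.  Each minterm is a nonempty subset of
the entities not containing `e` itself. -/
structure IIM (α : Type*) [Fintype α] [DecidableEq α] where
  idr : α → Finset (Finset α)
  minterm_nonempty : ∀ e s, s ∈ idr e → s.Nonempty
  minterm_not_self : ∀ e s, s ∈ idr e → e ∉ s

namespace IIM

variable {α : Type*} [Fintype α] [DecidableEq α]

/-- The cascading-failure sequence `D_t` with initial failure set `S` and
hardened set `H`: `D_0 = S \ H` and `D_{t+1} = D_t ∪ {e ∈ E \ H : e has an IDR
and every minterm of its IDR contains some entity of D_t}`. -/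
def cascade (sys : IIM α) (S H : Finset α) : ℕ → Finset α
  | 0 => S \ H
  | t + 1 =>
    let D := sys.cascade S H t
    D ∪ Finset.univ.filter fun e =>
      e ∉ H ∧ (sys.idr e).Nonempty ∧ ∀ s ∈ sys.idr e, ∃ d ∈ D, d ∈ s

/-- `KillSet_H(S)`: the eventual (stable) value of the cascade, reached by
time step `|E| - 1`. -/
def killSetH (sys : IIM α) (S H : Finset α) : Finset α :=
  sys.cascade S H (Fintype.card α - 1)

/-- `KillSet(S) = KillSet_∅(S)`. -/
def killSet (sys : IIM α) (S : Finset α) : Finset α := sys.killSetH S ∅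

/-- The protection set `P(X|E') = KillSet(E') \ KillSet_X(E')`. -/
def protSet (sys : IIM α) (X E' : Finset α) : Finset α :=
  sys.killSet E' \ sys.killSetH E' X

/-- Restricted Case I: every IDR consists of exactly one minterm, of size one. -/
def RestrictedI (sys : IIM α) : Prop :=
  (∀ e, (sys.idr e).card ≤ 1) ∧ ∀ e s, s ∈ sys.idr e → s.card = 1

/-- Restricted Case II: every minterm of every IDR has size one. -/
def RestrictedII (sys : IIM α) : Prop :=
  ∀ e s, s ∈ sys.idr e → s.card = 1

end IIM

namespace IIM

variable {α : Type*} [Fintype α] [DecidableEq α]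

/-- One propagation step without hardening. -/
def stepAux (sys : IIM α) (D : Finset α) : Finset α :=
  D ∪ Finset.univ.filter fun e =>
      (sys.idr e).Nonempty ∧ ∀ s ∈ sys.idr e, ∃ d ∈ D, d ∈ s

theorem cascade_succ_aux (sys : IIM α) (S : Finset α) (t : ℕ) :
    sys.cascade S ∅ (t + 1) = sys.stepAux (sys.cascade S ∅ t) := by
  simp [cascade, stepAux]

theorem cascade_grow (sys : IIM α) (e : α) (t : ℕ) :
    sys.stepAux (sys.cascade {e} ∅ t) = sys.cascade {e} ∅ t ∨
      t + 1 ≤ (sys.cascade {e} ∅ t).card := by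
  induction t with
  | zero => right; simp [cascade]
  | succ t ih =>
    by_cases h : sys.stepAux (sys.cascade {e} ∅ t) = sys.cascade {e} ∅ t
    · left
      rw [cascade_succ_aux, h, h]
    · right
      have h1 := ih.resolve_left h
      have h2 : sys.cascade {e} ∅ t ⊂ sys.stepAux (sys.cascade {e} ∅ t) :=
        Finset.ssubset_iff_subset_ne.2 ⟨Finset.subset_union_left, fun h' => h h'.symm⟩
      have h3 := Finset.card_lt_card h2
      rw [cascade_succ_aux]
      omega

theorem killSet_fixed (sys : IIM α) (e : α) :
    sys.stepAux (sys.killSet {e}) = sys.killSet {e} := by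
  rcases sys.cascade_grow e (Fintype.card α - 1) with h | h
  · exact h
  · have hu : sys.killSet {e} = Finset.univ := by
      rw [← Finset.card_eq_iff_eq_univ]
      have := Finset.card_le_univ (sys.killSet {e})
      unfold killSet killSetH at *
      omega
    rw [hu]
    simp [stepAux]

theorem cascade_mono_aux (sys : IIM α) (S : Finset α) : Monotone (sys.cascade S ∅) :=
  monotone_nat_of_le_succ fun t => by
    rw [cascade_succ_aux]; exact Finset.subset_union_left

theorem self_mem_killSet (sys : IIM α) (e : α) : e ∈ sys.killSet {e} :=
  sys.cascade_mono_aux {e} (Nat.zero_le _) (by simp [cascade])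

/-- Kill sets are closed under propagation. -/
theorem cascade_subset_killSet (sys : IIM α) {a b : α} (h : a ∈ sys.killSet {b}) (t : ℕ) :
    sys.cascade {a} ∅ t ⊆ sys.killSet {b} := by
  induction t with
  | zero => simpa [cascade] using h
  | succ t ih =>
    rw [cascade_succ_aux, ← killSet_fixed]
    intro x hx
    simp only [stepAux, Finset.mem_union, Finset.mem_filter, Finset.mem_univ, true_and] at hx ⊢
    rcases hx with hx | ⟨hn, hx⟩
    · exact Or.inl (ih hx)
    · refine Or.inr ⟨hn, fun s hs => ?_⟩
      obtain ⟨d, hd, hds⟩ := hx s hs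
      exact ⟨d, ih hd, hds⟩

/-- Each failed entity is the initial one or fails because all its minterms are hit. -/
theorem cascade_cause (sys : IIM α) (e x : α) (t : ℕ) (hx : x ∈ sys.cascade {e} ∅ t) :
    x = e ∨ ((sys.idr x).Nonempty ∧
      ∀ s ∈ sys.idr x, ∃ d ∈ sys.cascade {e} ∅ t, d ∈ s) := by
  induction t with
  | zero => left; simpa [cascade] using hx
  | succ t ih =>
    have hm := sys.cascade_mono_aux {e} (Nat.le_succ t)
    rw [cascade_succ_aux] at hx
    simp only [stepAux, Finset.mem_union, Finset.mem_filter, Finset.mem_univ, true_and] at hx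
    have key : x = e ∨ ((sys.idr x).Nonempty ∧
        ∀ s ∈ sys.idr x, ∃ d ∈ sys.cascade {e} ∅ t, d ∈ s) := by
      rcases hx with hx | hx
      · exact ih hx
      · exact Or.inr hx
    refine key.imp_right fun ⟨hn, h⟩ => ⟨hn, fun s hs => ?_⟩
    obtain ⟨d, hd, hds⟩ := h s hs
    exact ⟨d, hm hd, hds⟩

theorem meet_aux (sys : IIM α) (hres : sys.RestrictedI) (a b : α) (t : ℕ) :
    ∀ x ∈ sys.cascade {a} ∅ t, x ∈ sys.killSet {a} → x ∈ sys.killSet {b} →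
      a ∈ sys.killSet {b} ∨ b ∈ sys.killSet {a} := by
  induction t with
  | zero =>
    intro x hx _ hb
    have : x = a := by simpa [cascade] using hx
    exact Or.inl (this ▸ hb)
  | succ t ih =>
    intro x hx ha hb
    rw [cascade_succ_aux] at hx
    simp only [stepAux, Finset.mem_union, Finset.mem_filter, Finset.mem_univ, true_and] at hx
    rcases hx with hx | ⟨⟨s, hs⟩, hx⟩
    · exact ih x hx ha hb
    · rcases sys.cascade_cause b x _ hb with rfl | ⟨_, hc⟩
      · exact Or.inr ha
      · obtain ⟨d, hd, hds⟩ := hx s hs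
        obtain ⟨d', hd', hds'⟩ := hc s hs
        have hdd : d' = d := Finset.card_le_one.1 (hres.2 x s hs).le d' hds' d hds
        subst hdd
        exact ih d' hd (sys.cascade_subset_killSet (sys.self_mem_killSet a) t hd) hd'

end IIM

/-- In a system satisfying Restricted Case I, the kill sets of
any two entities are either disjoint, or one is contained in the other (their
intersection is `∅`, or equals one of the two kill sets). -/
theorem killSets_disjoint_or_nested {α : Type*} [Fintype α] [DecidableEq α]
    (sys : IIM α) (hres : sys.RestrictedI) (e_i e_j : α) :
    sys.killSet {e_i} ∩ sys.killSet {e_j} = ∅ ∨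
    sys.killSet {e_i} ∩ sys.killSet {e_j} = sys.killSet {e_i} ∨
    sys.killSet {e_i} ∩ sys.killSet {e_j} = sys.killSet {e_j} := by
  rcases Finset.eq_empty_or_nonempty (sys.killSet {e_i} ∩ sys.killSet {e_j}) with h | ⟨x, hx⟩
  · exact Or.inl h
  · right
    rw [Finset.mem_inter] at hx
    rcases sys.meet_aux hres e_i e_j _ x hx.1 hx.1 hx.2 with h | h
    · exact Or.inl (Finset.inter_eq_left.2 (sys.cascade_subset_killSet h _))
    · exact Or.inr (Finset.inter_eq_right.2 (sys.cascade_subset_killSet h _))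
end

section
/- Given a system satisfying Restricted Case I with initial failure set E' ⊆ E, for any two distinct entities e_i and e_j exactly one of the following holds for their protection sets: (a) P(e_i|E') ⊆ P(e_j|E'), (b) P(e_j|E') ⊆ P(e_i|E'), or (c) P(e_i|E') ∩ P(e_j|E') = ∅. -/
open Finset

namespace IIM

/-- Inductive reachability description of the kill set in Restricted Case I. -/
inductive Reach {α : Type*} [Fintype α] [DecidableEq α] (sys : IIM α) (S H : Finset α) : α → Prop
  | base (x : α) (hS : x ∈ S) (hH : x ∉ H) : Reach sys S H x
  | step (x y : α) (hH : x ∉ H) (hp : {y} ∈ sys.idr x) (hy : Reach sys S H y) : Reach sys S H x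

theorem cascade_succ {α : Type*} [Fintype α] [DecidableEq α] (sys : IIM α) (S H : Finset α)
    (t : ℕ) : sys.cascade S H (t + 1) = sys.cascade S H t ∪ Finset.univ.filter fun e =>
      e ∉ H ∧ (sys.idr e).Nonempty ∧ ∀ s ∈ sys.idr e, ∃ d ∈ sys.cascade S H t, d ∈ s := rfl

theorem stable_or_card {α : Type*} [Fintype α] [DecidableEq α] (sys : IIM α) (S H : Finset α)
    (t : ℕ) : sys.cascade S H (t + 1) = sys.cascade S H t ∨ t + 1 ≤ (sys.cascade S H t).card := by
  induction t with
  | zero =>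
    by_cases h : sys.cascade S H 0 = ∅
    · left
      rw [cascade_succ, h]
      ext e
      simp only [Finset.mem_union, Finset.mem_filter, Finset.notMem_empty, false_or, iff_false]
      rintro ⟨_, _, ⟨s, hs⟩, h2⟩
      obtain ⟨d, hd, _⟩ := h2 s hs
      exact hd
    · right
      have := Finset.card_pos.mpr (Finset.nonempty_iff_ne_empty.mpr h)
      omega
  | succ t ih =>
    by_cases h : sys.cascade S H (t + 1) = sys.cascade S H t
    · left
      rw [cascade_succ sys S H (t + 1), h, ← cascade_succ, h]
    · right
      have h1 := ih.resolve_left h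
      have hsub : sys.cascade S H t ⊆ sys.cascade S H (t + 1) := by
        rw [cascade_succ]; exact Finset.subset_union_left
      have := Finset.card_lt_card (hsub.ssubset_of_ne (Ne.symm h))
      omega

theorem killSetH_stable {α : Type*} [Fintype α] [DecidableEq α] (sys : IIM α) (S H : Finset α) :
    sys.cascade S H (Fintype.card α - 1 + 1) = sys.killSetH S H := by
  rcases stable_or_card sys S H (Fintype.card α - 1) with h | h
  · exact h
  · have hle := Finset.card_le_univ (sys.cascade S H (Fintype.card α - 1))
    have hu : sys.cascade S H (Fintype.card α - 1) = Finset.univ :=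
      Finset.eq_univ_of_card _ (by omega)
    rw [cascade_succ, killSetH, hu]
    exact Finset.union_eq_left.mpr (Finset.subset_univ _)

theorem base_mem {α : Type*} [Fintype α] [DecidableEq α] (sys : IIM α) (S H : Finset α)
    (x : α) (hx : x ∈ S \ H) (t : ℕ) : x ∈ sys.cascade S H t := by
  induction t with
  | zero => exact hx
  | succ t ih => rw [cascade_succ]; exact Finset.mem_union_left _ ih

theorem mem_killSetH {α : Type*} [Fintype α] [DecidableEq α] (sys : IIM α)
    (hres : sys.RestrictedI) (S H : Finset α) (x : α) :
    x ∈ sys.killSetH S H ↔ Reach sys S H x := by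
  constructor
  · unfold killSetH
    generalize Fintype.card α - 1 = t
    induction t generalizing x with
    | zero =>
      intro h
      have h' : x ∈ S \ H := h
      rw [Finset.mem_sdiff] at h'
      exact Reach.base x h'.1 h'.2
    | succ t ih =>
      intro h
      rw [cascade_succ, Finset.mem_union, Finset.mem_filter] at h
      rcases h with h | ⟨_, hH, ⟨s, hs⟩, h2⟩
      · exact ih x h
      · obtain ⟨d, hd, hds⟩ := h2 s hs
        obtain ⟨y, rfl⟩ := Finset.card_eq_one.mp (hres.2 x s hs)
        rw [Finset.mem_singleton] at hds
        subst hds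
        exact Reach.step x d hH hs (ih d hd)
  · intro h
    induction h with
    | base x hS hH => exact base_mem sys S H x (Finset.mem_sdiff.mpr ⟨hS, hH⟩) _
    | step x y hH hp hy ih =>
      rw [← killSetH_stable, cascade_succ, Finset.mem_union, Finset.mem_filter]
      right
      refine ⟨Finset.mem_univ _, hH, ⟨_, hp⟩, fun s hs => ⟨y, ih, ?_⟩⟩
      rw [Finset.card_le_one.mp (hres.1 x) s hs {y} hp]
      exact Finset.mem_singleton_self y

theorem mem_protSet {α : Type*} [Fintype α] [DecidableEq α] (sys : IIM α)
    (hres : sys.RestrictedI) (S X : Finset α) (x : α) :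
    x ∈ sys.protSet X S ↔ Reach sys S ∅ x ∧ ¬ Reach sys S X x := by
  rw [protSet, Finset.mem_sdiff, killSet, mem_killSetH sys hres, mem_killSetH sys hres]

theorem reach_aux {α : Type*} [Fintype α] [DecidableEq α] (sys : IIM α) (S : Finset α)
    (i j y : α) (hj : Reach sys S {j} y) (hi : ¬ Reach sys S {i} y) : Reach sys S {j} i := by
  induction hj with
  | base y hS hH =>
    by_cases h : y = i
    · subst h; exact Reach.base y hS hH
    · exact absurd (Reach.base y hS (by simpa using h)) hi
  | step y z hH hp hz ih =>
    by_cases h : y = i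
    · subst h; exact Reach.step y z hH hp hz
    · exact ih fun hz' => hi (Reach.step y z (by simpa using h) hp hz')

theorem protSet_subset {α : Type*} [Fintype α] [DecidableEq α] (sys : IIM α)
    (hres : sys.RestrictedI) (S : Finset α) (i j : α) (h : ¬ Reach sys S {j} i) :
    sys.protSet {i} S ⊆ sys.protSet {j} S := by
  intro y hy
  rw [mem_protSet sys hres] at hy ⊢
  exact ⟨hy.1, fun hj => h (reach_aux sys S i j y hj hy.2)⟩

theorem common_aux {α : Type*} [Fintype α] [DecidableEq α] (sys : IIM α) (S : Finset α)
    (i j x : α) (hne : i ≠ j) (h : Reach sys S ∅ x) (hi : ¬ Reach sys S {i} x)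
    (hj : ¬ Reach sys S {j} x) : ¬ Reach sys S {j} i ∨ ¬ Reach sys S {i} j := by
  by_cases h1 : x = i
  · subst h1; exact Or.inl hj
  by_cases h2 : x = j
  · subst h2; exact Or.inr hi
  induction h with
  | base x hS _ => exact absurd (Reach.base x hS (by simpa using h1)) hi
  | step x z _ hp hz ih =>
    have hi' : ¬ Reach sys S {i} z := fun hz' => hi (Reach.step x z (by simpa using h1) hp hz')
    have hj' : ¬ Reach sys S {j} z := fun hz' => hj (Reach.step x z (by simpa using h2) hp hz')
    by_cases h3 : z = i
    · subst h3; exact Or.inl hj'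
    by_cases h4 : z = j
    · subst h4; exact Or.inr hi'
    exact ih hi' hj' h3 h4

end IIM

/-- In a system satisfying Restricted Case I with initial
failure set `E'`, for any two distinct entities `e_i ≠ e_j` the protection
sets satisfy `P(e_i|E') ⊆ P(e_j|E')`, or `P(e_j|E') ⊆ P(e_i|E')`, or
`P(e_i|E') ∩ P(e_j|E') = ∅`. -/
theorem protSets_nested_or_disjoint {α : Type*} [Fintype α] [DecidableEq α]
    (sys : IIM α) (hres : sys.RestrictedI) (E' : Finset α)
    (e_i e_j : α) (hne : e_i ≠ e_j) :
    sys.protSet {e_i} E' ⊆ sys.protSet {e_j} E' ∨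
    sys.protSet {e_j} E' ⊆ sys.protSet {e_i} E' ∨
    sys.protSet {e_i} E' ∩ sys.protSet {e_j} E' = ∅ := by
  by_cases h : sys.protSet {e_i} E' ∩ sys.protSet {e_j} E' = ∅
  · exact Or.inr (Or.inr h)
  · obtain ⟨x, hx⟩ := Finset.nonempty_iff_ne_empty.mpr h
    rw [Finset.mem_inter, IIM.mem_protSet sys hres, IIM.mem_protSet sys hres] at hx
    rcases IIM.common_aux sys E' e_i e_j x hne hx.1.1 hx.1.2 hx.2.2 with h | h
    · exact Or.inl (IIM.protSet_subset sys hres E' e_i e_j h)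
    · exact Or.inr (Or.inl (IIM.protSet_subset sys hres E' e_j e_i h))
end

section
/- In a system satisfying Restricted Case II with initial failure set E' ⊆ E, for any two entities e_i and e_j, the protection set obtained by hardening both entities equals the union of their individual protection sets: P({e_i, e_j}|E') = P(e_i|E') ∪ P(e_j|E'). -/
open Finset

theorem IIM.cascade_mem_succ {α : Type*} [Fintype α] [DecidableEq α]
    (sys : IIM α) (S H : Finset α) (t : ℕ) (e : α) :
    e ∈ sys.cascade S H (t + 1) ↔ e ∉ H ∧ (e ∈ S ∨ ((sys.idr e).Nonempty ∧
      ∀ s ∈ sys.idr e, ∃ d ∈ sys.cascade S H t, d ∈ s)) := by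
  induction t generalizing e with
  | zero =>
    simp only [IIM.cascade, mem_union, mem_filter, mem_univ, true_and, mem_sdiff]
    tauto
  | succ t ih =>
    have hsub : sys.cascade S H t ⊆ sys.cascade S H (t + 1) := by
      intro x hx
      rw [IIM.cascade]
      exact mem_union_left _ hx
    rw [IIM.cascade]
    simp only [mem_union, mem_filter, mem_univ, true_and]
    constructor
    · rintro (h | h)
      · obtain ⟨h1, h2⟩ := (ih e).1 h
        refine ⟨h1, h2.imp_right ?_⟩
        rintro ⟨h3, h4⟩
        refine ⟨h3, fun s hs => ?_⟩
        obtain ⟨d, hd, hds⟩ := h4 s hs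
        exact ⟨d, hsub hd, hds⟩
      · exact ⟨h.1, Or.inr h.2⟩
    · rintro ⟨h1, h | h⟩
      · exact Or.inl ((ih e).2 ⟨h1, Or.inl h⟩)
      · exact Or.inr ⟨h1, h⟩

theorem IIM.cascade_anti {α : Type*} [Fintype α] [DecidableEq α]
    (sys : IIM α) (S H H' : Finset α) (hH : H ⊆ H') (t : ℕ) (e : α)
    (he : e ∈ sys.cascade S H' t) : e ∈ sys.cascade S H t := by
  induction t generalizing e with
  | zero =>
    simp only [IIM.cascade, mem_sdiff] at he ⊢
    exact ⟨he.1, fun h => he.2 (hH h)⟩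
  | succ t ih =>
    rw [IIM.cascade_mem_succ] at he ⊢
    refine ⟨fun h => he.1 (hH h), he.2.imp_right ?_⟩
    rintro ⟨h3, h4⟩
    refine ⟨h3, fun s hs => ?_⟩
    obtain ⟨d, hd, hds⟩ := h4 s hs
    exact ⟨d, ih d hd, hds⟩

theorem IIM.cascade_inter {α : Type*} [Fintype α] [DecidableEq α]
    (sys : IIM α) (hres : sys.RestrictedII) (S : Finset α) (i j : α) (t : ℕ) (e : α)
    (h1 : e ∈ sys.cascade S {i} t) (h2 : e ∈ sys.cascade S {j} t) :
    e ∈ sys.cascade S {i, j} t := by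
  induction t generalizing e with
  | zero =>
    simp only [IIM.cascade, mem_sdiff, mem_insert, mem_singleton] at *
    tauto
  | succ t ih =>
    rw [IIM.cascade_mem_succ] at h1 h2 ⊢
    obtain ⟨a1, b1⟩ := h1
    obtain ⟨a2, b2⟩ := h2
    refine ⟨by simp only [mem_insert, mem_singleton] at *; tauto, ?_⟩
    rcases b1 with b1 | ⟨n, b1⟩
    · exact Or.inl b1
    rcases b2 with b2 | ⟨_, b2⟩
    · exact Or.inl b2
    refine Or.inr ⟨n, fun s hs => ?_⟩
    obtain ⟨x, rfl⟩ := card_eq_one.1 (hres e s hs)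
    obtain ⟨d, hd, hds⟩ := b1 _ hs
    obtain ⟨d', hd', hds'⟩ := b2 _ hs
    rw [mem_singleton] at hds hds'
    subst hds
    subst hds'
    exact ⟨_, ih _ hd hd', mem_singleton_self _⟩

/-- In a system satisfying Restricted Case II with initial
failure set `E'`, for any two entities `e_i, e_j`:
`P({e_i, e_j}|E') = P(e_i|E') ∪ P(e_j|E')`. -/
theorem protSet_pair_union {α : Type*} [Fintype α] [DecidableEq α]
    (sys : IIM α) (hres : sys.RestrictedII) (E' : Finset α) (e_i e_j : α) :
    sys.protSet {e_i, e_j} E' = sys.protSet {e_i} E' ∪ sys.protSet {e_j} E' := by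
  ext e
  have h1 := sys.cascade_inter hres E' e_i e_j (Fintype.card α - 1) e
  have h2 := sys.cascade_anti E' {e_i} {e_i, e_j} (by simp) (Fintype.card α - 1) e
  have h3 := sys.cascade_anti E' {e_j} {e_i, e_j} (by simp) (Fintype.card α - 1) e
  simp only [IIM.protSet, IIM.killSetH, mem_union, mem_sdiff]
  tauto
end

section
/- In a system satisfying Restricted Case I with initial failure set E' ⊆ E, the set E' can be partitioned into subsets E_{X_1}, …, E_{X_m} such that (i) for any two entities e_a ∈ E_{X_i} and e_b ∈ E_{X_j} with i ≠ j, KillSet({e_a}) ∩ KillSet({e_b}) = ∅, and (ii) each subset E_{X_z} contains an entity e_k whose kill set is a superset of the kill set of every other entity in E_{X_z}. -/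
open Finset

theorem laminar_partition_aux {α : Type*} [DecidableEq α]
    (K : α → Finset α) (hself : ∀ a, a ∈ K a)
    (hnest : ∀ a b, (∃ c, c ∈ K a ∧ c ∈ K b) → K a ⊆ K b ∨ K b ⊆ K a) (E' : Finset α) :
    ∃ Par : Finset (Finset α),
      (∀ p ∈ Par, p ⊆ E') ∧
      (∀ p ∈ Par, p.Nonempty) ∧
      (∀ p ∈ Par, ∀ q ∈ Par, p ≠ q → Disjoint p q) ∧
      Par.biUnion id = E' ∧
      (∀ p ∈ Par, ∀ q ∈ Par, p ≠ q → ∀ e_a ∈ p, ∀ e_b ∈ q,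
        K e_a ∩ K e_b = ∅) ∧
      (∀ p ∈ Par, ∃ e_k ∈ p, ∀ e ∈ p, K e ⊆ K e_k) := by
  classical
  have key : ∀ m ∈ E', (∀ f ∈ E', K m ⊆ K f → K f ⊆ K m) →
      ∀ m' ∈ E', (∀ f ∈ E', K m' ⊆ K f → K f ⊆ K m') →
      E'.filter (fun x => K x ⊆ K m) ≠ E'.filter (fun x => K x ⊆ K m') →
      ∀ c, c ∈ K m → c ∈ K m' → False := by
    intro m hm hmax m' hm' hmax' hne c hc hc'
    apply hne
    have heq : K m = K m' := by
      rcases hnest m m' ⟨c, hc, hc'⟩ with h | h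
      · exact Finset.Subset.antisymm h (hmax m' hm' h)
      · exact Finset.Subset.antisymm (hmax' m hm h) h
    rw [heq]
  refine ⟨(E'.filter (fun e => ∀ f ∈ E', K e ⊆ K f → K f ⊆ K e)).image
    (fun e => E'.filter (fun x => K x ⊆ K e)), ?_, ?_, ?_, ?_, ?_, ?_⟩
  · intro p hp
    simp only [Finset.mem_image, Finset.mem_filter] at hp
    obtain ⟨m, hm, rfl⟩ := hp
    exact Finset.filter_subset _ _
  · intro p hp
    simp only [Finset.mem_image, Finset.mem_filter] at hp
    obtain ⟨m, hm, rfl⟩ := hp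
    exact ⟨m, by simp [hm.1]⟩
  · intro p hp q hq hne
    simp only [Finset.mem_image, Finset.mem_filter] at hp hq
    obtain ⟨m, hm, rfl⟩ := hp
    obtain ⟨m', hm', rfl⟩ := hq
    rw [Finset.disjoint_left]
    intro x hx hx'
    rw [Finset.mem_filter] at hx hx'
    exact key m hm.1 hm.2 m' hm'.1 hm'.2 hne x (hx.2 (hself x)) (hx'.2 (hself x))
  · ext x
    simp only [Finset.mem_biUnion, Finset.mem_image, Finset.mem_filter, id]
    constructor
    · rintro ⟨p, ⟨m, hm, rfl⟩, hx⟩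
      exact (Finset.mem_filter.1 hx).1
    · intro hx
      obtain ⟨m, hm, hmax⟩ := Finset.exists_max_image (E'.filter (fun f => K x ⊆ K f))
        (fun f => (K f).card) ⟨x, by simp [hx]⟩
      rw [Finset.mem_filter] at hm
      refine ⟨_, ⟨m, ⟨hm.1, ?_⟩, rfl⟩, Finset.mem_filter.2 ⟨hx, hm.2⟩⟩
      intro f hf hmf
      have := hmax f (Finset.mem_filter.2 ⟨hf, hm.2.trans hmf⟩)
      rw [Finset.eq_of_subset_of_card_le hmf this]
  · intro p hp q hq hne a ha b hb
    simp only [Finset.mem_image, Finset.mem_filter] at hp hq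
    obtain ⟨m, hm, rfl⟩ := hp
    obtain ⟨m', hm', rfl⟩ := hq
    rw [Finset.mem_filter] at ha hb
    rw [Finset.eq_empty_iff_forall_notMem]
    intro c hc
    rw [Finset.mem_inter] at hc
    exact key m hm.1 hm.2 m' hm'.1 hm'.2 hne c (ha.2 hc.1) (hb.2 hc.2)
  · intro p hp
    simp only [Finset.mem_image, Finset.mem_filter] at hp
    obtain ⟨m, hm, rfl⟩ := hp
    exact ⟨m, by simp [hm.1], fun e he => (Finset.mem_filter.1 he).2⟩

section KillAux
variable {α : Type*} [Fintype α] [DecidableEq α]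

theorem mem_cascade_succ_aux (sys : IIM α) (S : Finset α) (t : ℕ) (e : α) :
    e ∈ sys.cascade S ∅ (t + 1) ↔ e ∈ sys.cascade S ∅ t ∨
      ((sys.idr e).Nonempty ∧ ∀ s ∈ sys.idr e, ∃ d ∈ sys.cascade S ∅ t, d ∈ s) := by
  simp [IIM.cascade]

theorem cascade_growth_aux (sys : IIM α) (a : α) (t : ℕ) :
    sys.cascade {a} ∅ (t + 1) = sys.cascade {a} ∅ t ∨
      t + 1 ≤ (sys.cascade {a} ∅ t).card := by
  induction t with
  | zero => right; simp [IIM.cascade]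
  | succ t ih =>
    by_cases h : sys.cascade {a} ∅ (t + 1) = sys.cascade {a} ∅ t
    · left
      ext e
      rw [mem_cascade_succ_aux, h, ← mem_cascade_succ_aux, h]
    · right
      have h1 := ih.resolve_left h
      have hsub : sys.cascade {a} ∅ t ⊆ sys.cascade {a} ∅ (t + 1) := fun e he =>
        (mem_cascade_succ_aux sys _ t e).2 (Or.inl he)
      have := Finset.card_lt_card (hsub.ssubset_of_ne (Ne.symm h))
      omega

theorem killSet_stable_aux (sys : IIM α) (a : α) :
    sys.cascade {a} ∅ (Fintype.card α - 1 + 1) = sys.killSet {a} := by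
  rcases cascade_growth_aux sys a (Fintype.card α - 1) with h | h
  · exact h
  · have hu : sys.cascade {a} ∅ (Fintype.card α - 1) = Finset.univ := by
      apply Finset.eq_univ_of_card
      have := Finset.card_le_univ (sys.cascade {a} ∅ (Fintype.card α - 1))
      omega
    change _ = sys.cascade {a} ∅ (Fintype.card α - 1)
    ext e
    rw [mem_cascade_succ_aux, hu]
    simp

theorem self_mem_killSet_aux (sys : IIM α) (a : α) : a ∈ sys.killSet {a} := by
  have : ∀ t, a ∈ sys.cascade {a} ∅ t := by
    intro t
    induction t with
    | zero => simp [IIM.cascade]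
    | succ t ih => exact (mem_cascade_succ_aux sys _ t a).2 (Or.inl ih)
  exact this _

/-- Under Restricted Case I, the cascade step in terms of the unique parent. -/
theorem step_aux (sys : IIM α) (hres : sys.RestrictedI) (D : Finset α) (e : α) :
    ((sys.idr e).Nonempty ∧ ∀ s ∈ sys.idr e, ∃ d ∈ D, d ∈ s) ↔
      ∃ d ∈ D, sys.idr e = {{d}} := by
  constructor
  · rintro ⟨⟨s, hs⟩, h⟩
    obtain ⟨d, hd, hds⟩ := h s hs
    obtain ⟨x, rfl⟩ := Finset.card_eq_one.1 (hres.2 e s hs)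
    rw [Finset.mem_singleton] at hds
    subst hds
    refine ⟨d, hd, ?_⟩
    exact (Finset.eq_of_subset_of_card_le (Finset.singleton_subset_iff.2 hs)
      (by simpa using hres.1 e)).symm
  · rintro ⟨d, hd, h⟩
    rw [h]
    simp [hd]

theorem killSet_closed_aux (sys : IIM α) (hres : sys.RestrictedI) (a d e : α)
    (hd : d ∈ sys.killSet {a}) (he : sys.idr e = {{d}}) : e ∈ sys.killSet {a} := by
  rw [← killSet_stable_aux, mem_cascade_succ_aux]
  exact Or.inr ((step_aux sys hres _ e).2 ⟨d, hd, he⟩)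

theorem killSet_induction_aux (sys : IIM α) (hres : sys.RestrictedI) (a : α) (P : α → Prop)
    (h0 : P a)
    (hs : ∀ d e, d ∈ sys.killSet {a} → e ∈ sys.killSet {a} → sys.idr e = {{d}} → P d → P e)
    (c : α) (hc : c ∈ sys.killSet {a}) : P c := by
  have : ∀ t, ∀ c ∈ sys.cascade {a} ∅ t, c ∈ sys.killSet {a} ∧ P c := by
    intro t
    induction t with
    | zero =>
      intro c hc
      have : c = a := by simpa [IIM.cascade] using hc
      subst this
      exact ⟨self_mem_killSet_aux sys c, h0⟩
    | succ t ih =>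
      intro c hc
      rw [mem_cascade_succ_aux, step_aux sys hres] at hc
      rcases hc with hc | ⟨d, hd, he⟩
      · exact ih c hc
      · have h1 := ih d hd
        have h2 := killSet_closed_aux sys hres a d c h1.1 he
        exact ⟨h2, hs d c h1.1 h2 he h1.2⟩
  exact (this _ c hc).2

theorem killSet_subset_aux (sys : IIM α) (hres : sys.RestrictedI) (a b : α)
    (hb : b ∈ sys.killSet {a}) : sys.killSet {b} ⊆ sys.killSet {a} := fun c hc =>
  killSet_induction_aux sys hres b (fun c => c ∈ sys.killSet {a}) hb
    (fun d e _ _ he hd => killSet_closed_aux sys hres a d e hd he) c hc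

theorem killSet_inv_aux (sys : IIM α) (hres : sys.RestrictedI) (a c d : α)
    (hc : c ∈ sys.killSet {a}) (hd : sys.idr c = {{d}}) : c = a ∨ d ∈ sys.killSet {a} :=
  killSet_induction_aux sys hres a
    (fun c => ∀ d, sys.idr c = {{d}} → c = a ∨ d ∈ sys.killSet {a})
    (fun _ _ => Or.inl rfl)
    (fun d e hd _ he _ d' he' => by
      have : d = d' := by simpa using he.symm.trans he'
      exact Or.inr (this ▸ hd)) c hc d hd

theorem killSet_nest_aux (sys : IIM α) (hres : sys.RestrictedI) (a b : α)
    (h : ∃ c, c ∈ sys.killSet {a} ∧ c ∈ sys.killSet {b}) :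
    sys.killSet {a} ⊆ sys.killSet {b} ∨ sys.killSet {b} ⊆ sys.killSet {a} := by
  obtain ⟨c, hca, hcb⟩ := h
  have := killSet_induction_aux sys hres a
    (fun c => c ∈ sys.killSet {b} → a ∈ sys.killSet {b} ∨ b ∈ sys.killSet {a})
    Or.inl
    (fun d e hd he hde ih heb => by
      rcases killSet_inv_aux sys hres b e d heb hde with h | h
      · exact Or.inr (h ▸ he)
      · exact ih h) c hca hcb
  exact this.imp (killSet_subset_aux sys hres b a) (killSet_subset_aux sys hres a b)

end KillAux

/-- In a system satisfying Restricted Case I with initial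
failure set `E'`, the set `E'` can be partitioned into subsets such that
(i) kill sets of entities lying in different parts are disjoint, and
(ii) each part contains an entity whose kill set is a superset of the kill
set of every other entity in that part. -/
theorem killSet_partition {α : Type*} [Fintype α] [DecidableEq α]
    (sys : IIM α) (hres : sys.RestrictedI) (E' : Finset α) :
    ∃ Par : Finset (Finset α),
      (∀ p ∈ Par, p ⊆ E') ∧
      (∀ p ∈ Par, p.Nonempty) ∧
      (∀ p ∈ Par, ∀ q ∈ Par, p ≠ q → Disjoint p q) ∧
      Par.biUnion id = E' ∧
      (∀ p ∈ Par, ∀ q ∈ Par, p ≠ q → ∀ e_a ∈ p, ∀ e_b ∈ q,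
        sys.killSet {e_a} ∩ sys.killSet {e_b} = ∅) ∧
      (∀ p ∈ Par, ∃ e_k ∈ p, ∀ e ∈ p, sys.killSet {e} ⊆ sys.killSet {e_k}) := by
  exact laminar_partition_aux (fun e => sys.killSet {e}) (self_mem_killSet_aux sys)
    (killSet_nest_aux sys hres) E'
end

section
/- In a system satisfying Restricted Case I with initial failure set E' ⊆ E and any hardening budget k, an optimal hardening set can be chosen among the initially failing entities: the maximum of |P(H|E')| over all H ⊆ E with |H| ≤ k equals the maximum of |P(S|E')| over all S ⊆ E' with |S| ≤ k. -/
open Finset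

namespace IIM

variable {α : Type*} [Fintype α] [DecidableEq α]

/-- `r` is the first entity of `E'` met when following the dependencies upwards from `x`. -/
inductive FirstAnc (sys : IIM α) (E' : Finset α) : α → α → Prop
  | base (r : α) (h : r ∈ E') : FirstAnc sys E' r r
  | step (x p r : α) (hx : x ∉ E') (hp : {p} ∈ sys.idr x) (h : FirstAnc sys E' p r) :
      FirstAnc sys E' x r

theorem FirstAnc.mem {sys : IIM α} {E' : Finset α} {x r : α} (h : FirstAnc sys E' x r) :
    r ∈ E' := by
  induction h with
  | base r h => exact h
  | step x p r hx hp h ih => exact ih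

theorem FirstAnc.unique {sys : IIM α} (hres : sys.RestrictedI) {E' : Finset α} {x r r' : α}
    (h : FirstAnc sys E' x r) (h' : FirstAnc sys E' x r') : r = r' := by
  induction h with
  | base r h =>
    cases h' with
    | base _ _ => rfl
    | step _ p _ hx _ _ => exact absurd h hx
  | step x p r hx hp h ih =>
    cases h' with
    | base _ hb => exact absurd hb hx
    | step _ q _ _ hq h2 =>
      have he : ({p} : Finset α) = {q} := Finset.card_le_one.mp (hres.1 x) _ hp _ hq
      have : p = q := Finset.singleton_injective he
      subst this
      exact ih h2

theorem cascade_key (sys : IIM α) (hres : sys.RestrictedI) (E' H S : Finset α)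
    (hS : ∀ x ∈ H, ∀ r, FirstAnc sys E' x r → r ∈ S) (t : ℕ) :
    ∀ x ∈ sys.cascade E' S t, x ∈ sys.cascade E' H t ∧ ∃ r, FirstAnc sys E' x r ∧ r ∉ S := by
  induction t with
  | zero =>
    intro x hx
    simp only [cascade, mem_sdiff] at hx ⊢
    exact ⟨⟨hx.1, fun hH => hx.2 (hS x hH x (.base x hx.1))⟩, x, .base x hx.1, hx.2⟩
  | succ t ih =>
    intro x hx
    simp only [cascade, mem_union, mem_filter, mem_univ, true_and] at hx ⊢
    rcases hx with hx | ⟨hxS, ⟨s, hs⟩, hall⟩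
    · exact ⟨Or.inl (ih x hx).1, (ih x hx).2⟩
    · obtain ⟨p, hpD, hps⟩ := hall s hs
      obtain ⟨q, rfl⟩ := Finset.card_eq_one.mp (hres.2 x s hs)
      obtain rfl : p = q := by simpa using hps
      obtain ⟨hpH, r, hr, hrS⟩ := ih p hpD
      have hex : ∃ r, FirstAnc sys E' x r ∧ r ∉ S := by
        by_cases hxE : x ∈ E'
        · exact ⟨x, .base x hxE, hxS⟩
        · exact ⟨r, .step x p r hxE hs hr, hrS⟩
      refine ⟨Or.inr ⟨?_, ⟨_, hs⟩, ?_⟩, hex⟩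
      · intro hH
        obtain ⟨r', h1, h2⟩ := hex
        exact h2 (hS x hH r' h1)
      · intro s' hs'
        have : s' = {p} := Finset.card_le_one.mp (hres.1 x) _ hs' _ hs
        exact ⟨p, hpH, by simp [this]⟩

end IIM

/-- In a system satisfying Restricted Case I with initial
failure set `E'` and hardening budget `k`, an optimal hardening set can be
chosen among the initially failing entities: the maximum of `|P(H|E')|` over
all `H ⊆ E` with `|H| ≤ k` equals the maximum of `|P(S|E')|` over all
`S ⊆ E'` with `|S| ≤ k`. -/
theorem hardening_optimum_within_initial {α : Type*} [Fintype α] [DecidableEq α]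
    (sys : IIM α) (hres : sys.RestrictedI) (E' : Finset α) (k : ℕ) :
    ((Finset.univ.powerset.filter fun H => H.card ≤ k).sup
        fun H => (sys.protSet H E').card) =
    ((E'.powerset.filter fun S => S.card ≤ k).sup
        fun S => (sys.protSet S E').card) := by
  classical
  apply le_antisymm
  · apply Finset.sup_le
    intro H hH
    have hk : H.card ≤ k := (Finset.mem_filter.mp hH).2
    let g : α → α := fun x =>
      if h : ∃ r, IIM.FirstAnc sys E' x r then h.choose else x
    let S := (H.filter fun x => ∃ r, IIM.FirstAnc sys E' x r).image g
    have hg : ∀ x, (∃ r, IIM.FirstAnc sys E' x r) → IIM.FirstAnc sys E' x (g x) := by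
      intro x h
      simp only [g, dif_pos h]
      exact h.choose_spec
    have hS : ∀ x ∈ H, ∀ r, IIM.FirstAnc sys E' x r → r ∈ S := by
      intro x hx r hr
      exact Finset.mem_image.mpr ⟨x, Finset.mem_filter.mpr ⟨hx, r, hr⟩,
        (hg x ⟨r, hr⟩).unique hres hr⟩
    have hSE : S ⊆ E' := by
      intro y hy
      obtain ⟨x, hx, rfl⟩ := Finset.mem_image.mp hy
      exact (hg x (Finset.mem_filter.mp hx).2).mem
    have hSk : S.card ≤ k :=
      (Finset.card_image_le.trans (Finset.card_filter_le _ _)).trans hk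
    refine le_trans ?_ (Finset.le_sup (f := fun S => (sys.protSet S E').card)
      (Finset.mem_filter.mpr ⟨Finset.mem_powerset.mpr hSE, hSk⟩))
    apply Finset.card_le_card
    apply Finset.sdiff_subset_sdiff (Finset.Subset.refl _)
    intro x hx
    exact (IIM.cascade_key sys hres E' H S hS _ x hx).1
  · apply Finset.sup_mono
    intro S hS
    simp only [Finset.mem_filter, Finset.mem_powerset] at hS ⊢
    exact ⟨Finset.subset_univ _, hS.2⟩
end

section
/- Correctness of the reduction from Densest p-Subhypergraph to Entity Hardening: let G = (V, E_V) be a finite hypergraph (E_V a finite family of nonempty subsets of V), and construct the system whose entity set is the disjoint union of {b_v : v ∈ V} and {a_e : e ∈ E_V}, where each a_e has the single IDR a_e ← ∏_{v ∈ e} b_v (one minterm consisting of {b_v : v ∈ e}) and the b_v have no IDRs; let the initial failure set be E' = {b_v : v ∈ V}. Then for any positive integers p ≤ |V| and M: there exists a hardening set H with |H| ≤ p such that |KillSet_H(E')| ≤ |V| + |E_V| − p − M if and only if there exists V' ⊆ V with |V'| ≤ p such that at least M hyperedges e ∈ E_V satisfy e ⊆ V'. -/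
open Finset

/-- The system built from a hypergraph `(V, EV)` for the reduction from
Densest p-Subhypergraph to Entity Hardening: entities are the disjoint union
of `{b_v : v ∈ V}` (elements `Sum.inl v`) and `{a_e : e ∈ EV}` (elements
`Sum.inr e`); each `a_e` has the single IDR `a_e ← ∏_{v ∈ e} b_v` (one
minterm `{b_v : v ∈ e}`), and the `b_v` have no IDRs. -/
def hyperSys (V : Type*) [Fintype V] [DecidableEq V]
    (EV : Finset (Finset V)) (hne : ∀ e ∈ EV, e.Nonempty) :
    IIM (V ⊕ {e : Finset V // e ∈ EV}) where
  idr x :=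
    match x with
    | Sum.inl _ => ∅
    | Sum.inr e => {e.1.image Sum.inl}
  minterm_nonempty := by
    rintro (v | e) s hs
    · simp at hs
    · simp only [Finset.mem_singleton] at hs
      subst hs
      exact (hne e.1 e.2).image _
  minterm_not_self := by
    rintro (v | e) s hs
    · simp at hs
    · simp only [Finset.mem_singleton] at hs
      subst hs
      simp

section Helpers

variable {V : Type*} [Fintype V] [DecidableEq V] (EV : Finset (Finset V))
  (hne : ∀ e ∈ EV, e.Nonempty)

theorem mem_cascade_inl (H : Finset (V ⊕ {e : Finset V // e ∈ EV})) (t : ℕ) (v : V) :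
    Sum.inl v ∈ (hyperSys V EV hne).cascade (Finset.univ.image Sum.inl) H t ↔
      Sum.inl v ∉ H := by
  induction t with
  | zero => simp [IIM.cascade]
  | succ t ih =>
    have : (hyperSys V EV hne).idr (Sum.inl v) = ∅ := rfl
    simp [IIM.cascade, ih, this]

theorem mem_cascade_inr (H : Finset (V ⊕ {e : Finset V // e ∈ EV})) (t : ℕ)
    (e : {e : Finset V // e ∈ EV}) :
    Sum.inr e ∈ (hyperSys V EV hne).cascade (Finset.univ.image Sum.inl) H (t + 1) ↔
      Sum.inr e ∉ H ∧ ∃ v ∈ e.1, Sum.inl v ∉ H := by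
  have key : ∀ t, (∃ d ∈ (hyperSys V EV hne).cascade (Finset.univ.image Sum.inl) H t,
      d ∈ e.1.image Sum.inl) ↔ ∃ v ∈ e.1, Sum.inl v ∉ H := by
    intro t
    constructor
    · rintro ⟨d, hd, hde⟩
      obtain ⟨v, hv, rfl⟩ := Finset.mem_image.1 hde
      exact ⟨v, hv, (mem_cascade_inl EV hne H t v).1 hd⟩
    · rintro ⟨v, hv, hvH⟩
      exact ⟨Sum.inl v, (mem_cascade_inl EV hne H t v).2 hvH, Finset.mem_image_of_mem _ hv⟩
  have step : ∀ t, Sum.inr e ∈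
      (hyperSys V EV hne).cascade (Finset.univ.image Sum.inl) H (t + 1) ↔
      Sum.inr e ∈ (hyperSys V EV hne).cascade (Finset.univ.image Sum.inl) H t ∨
      (Sum.inr e ∉ H ∧ ∃ v ∈ e.1, Sum.inl v ∉ H) := by
    intro t
    rw [← key t]
    simp only [IIM.cascade, Finset.mem_union, Finset.mem_filter, Finset.mem_univ, true_and]
    have : (hyperSys V EV hne).idr (Sum.inr e) = {e.1.image Sum.inl} := rfl
    rw [this]
    simp only [Finset.singleton_nonempty, true_and, Finset.mem_singleton, forall_eq]
  induction t with
  | zero => rw [step]; simp [IIM.cascade]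
  | succ t ih => rw [step]; exact ⟨fun h => h.elim ih.1 id, Or.inr⟩

/-- The hyperedge entities whose hyperedge lies inside `V'`. -/
def innerEdges (V' : Finset V) : Finset (V ⊕ {e : Finset V // e ∈ EV}) :=
  (Finset.univ.filter fun e : {e : Finset V // e ∈ EV} => e.1 ⊆ V').map
    Function.Embedding.inr

theorem card_innerEdges (V' : Finset V) :
    (innerEdges EV V').card = (EV.filter fun e => e ⊆ V').card := by
  rw [innerEdges, Finset.card_map]
  refine Finset.card_bij (fun e _ => e.1) ?_ ?_ ?_
  · intro a ha
    simpa using ha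
  · intro a _ b _ h
    exact Subtype.ext h
  · intro b hb
    obtain ⟨h1, h2⟩ := Finset.mem_filter.1 hb
    exact ⟨⟨b, h1⟩, by simpa using h2, rfl⟩

theorem compl_kill [Nonempty V] (H : Finset (V ⊕ {e : Finset V // e ∈ EV})) :
    ((hyperSys V EV hne).killSetH (Finset.univ.image Sum.inl) H)ᶜ =
      H ∪ innerEdges EV H.toLeft := by
  ext x
  rw [Finset.mem_compl, Finset.mem_union, IIM.killSetH]
  rcases x with v | e
  · rw [mem_cascade_inl]
    simp [innerEdges]
  · have h1 : 0 < Fintype.card V := Fintype.card_pos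
    have h2 : 0 < Fintype.card {e : Finset V // e ∈ EV} := Fintype.card_pos_iff.2 ⟨e⟩
    obtain ⟨t, ht⟩ : ∃ t, Fintype.card (V ⊕ {e : Finset V // e ∈ EV}) - 1 = t + 1 := by
      rw [Fintype.card_sum]
      exact ⟨Fintype.card V + Fintype.card {e : Finset V // e ∈ EV} - 2, by omega⟩
    rw [ht, mem_cascade_inr]
    have : (Sum.inr e ∈ innerEdges EV H.toLeft) ↔ ∀ v ∈ e.1, Sum.inl v ∈ H := by
      simp [innerEdges, Finset.subset_iff]
    rw [this]
    push Not
    tauto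

theorem card_kill [Nonempty V] (H : Finset (V ⊕ {e : Finset V // e ∈ EV})) :
    ((hyperSys V EV hne).killSetH (Finset.univ.image Sum.inl) H).card +
      (H ∪ innerEdges EV H.toLeft).card = Fintype.card V + EV.card := by
  rw [← compl_kill EV hne, Finset.card_add_card_compl, Fintype.card_sum, Fintype.card_coe]

end Helpers

/-- Correctness of the reduction from Densest p-Subhypergraph
to Entity Hardening: with initial failure set `E' = {b_v : v ∈ V}`, for any
positive integers `p ≤ |V|` and `M`, there is a hardening set `H` with
`|H| ≤ p` and `|KillSet_H(E')| ≤ |V| + |E_V| - p - M` iff there is `V' ⊆ V`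
with `|V'| ≤ p` such that at least `M` hyperedges `e ∈ E_V` satisfy `e ⊆ V'`. -/
theorem densest_subhypergraph_reduction {V : Type*} [Fintype V] [DecidableEq V]
    (EV : Finset (Finset V)) (hne : ∀ e ∈ EV, e.Nonempty)
    (p M : ℕ) (hp : 0 < p) (hpV : p ≤ Fintype.card V) (hM : 0 < M) :
    (∃ H : Finset (V ⊕ {e : Finset V // e ∈ EV}), H.card ≤ p ∧
      (((hyperSys V EV hne).killSetH (Finset.univ.image Sum.inl) H).card : ℤ) ≤
        (Fintype.card V : ℤ) + EV.card - p - M) ↔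
    (∃ V' : Finset V, V'.card ≤ p ∧ M ≤ (EV.filter fun e => e ⊆ V').card) := by
  have : Nonempty V := Fintype.card_pos_iff.1 (by omega)
  constructor
  · rintro ⟨H, hH, hK⟩
    refine ⟨H.toLeft, Finset.card_toLeft_le.trans hH, ?_⟩
    have h1 := card_kill EV hne H
    have h2 := Finset.card_union_le H (innerEdges EV H.toLeft)
    rw [← card_innerEdges]
    omega
  · rintro ⟨V', hV', hM'⟩
    obtain ⟨W, hVW, -, hW⟩ := Finset.exists_subsuperset_card_eq
      (Finset.subset_univ V') hV' (by simpa using hpV)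
    have hM2 : M ≤ (EV.filter fun e => e ⊆ W).card :=
      hM'.trans (Finset.card_le_card
        (Finset.monotone_filter_right _ fun e _ he => he.trans hVW))
    refine ⟨W.map Function.Embedding.inl, by simp [hW], ?_⟩
    have h1 := card_kill EV hne (W.map Function.Embedding.inl)
    have hl : (W.map Function.Embedding.inl :
        Finset (V ⊕ {e : Finset V // e ∈ EV})).toLeft = W := by
      ext v; simp
    rw [hl, Finset.card_union_of_disjoint, Finset.card_map, card_innerEdges, hW] at h1
    · omega
    · rw [Finset.disjoint_left]
      intro x hx hx2
      simp only [innerEdges, Finset.mem_map] at hx hx2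
      obtain ⟨v, -, rfl⟩ := hx
      obtain ⟨e, -, he⟩ := hx2
      simp at he
end

section
/- Correctness of the reduction from Set Cover to Entity Hardening under Restricted Case II: let U = {x_1, …, x_n} be a finite set and 𝒮 = {S_1, …, S_m} a family of subsets of U whose union is U, and construct the system whose entity set is the disjoint union of {a_i : x_i ∈ U} and {b_j : S_j ∈ 𝒮}, where each a_i has the IDR a_i ← Σ_{j : x_i ∈ S_j} b_j (one size-one minterm {b_j} for each j with x_i ∈ S_j) and the b_j have no IDRs; let the initial failure set be E' = {b_1, …, b_m}. Then for any positive integer M ≤ m: there exists a hardening set H with |H| ≤ M such that |KillSet_H(E')| ≤ m − M if and only if there exist at most M subsets in 𝒮 whose union equals U. -/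
open Finset

/-- The system built from a Set Cover instance `(U, 𝒮)` (with `U` the type
`β`): entities are the disjoint union of `{a_x : x ∈ U}` (elements
`Sum.inl x`) and `{b_S : S ∈ 𝒮}` (elements `Sum.inr S`); each `a_x` has the
IDR `a_x ← Σ_{S ∈ 𝒮, x ∈ S} b_S` (one size-one minterm `{b_S}` for each
`S ∈ 𝒮` containing `x`), and the `b_S` have no IDRs. -/
def setCoverSys (β : Type*) [Fintype β] [DecidableEq β]
    (𝒮 : Finset (Finset β)) : IIM (β ⊕ {S : Finset β // S ∈ 𝒮}) where
  idr x :=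
    match x with
    | Sum.inl a =>
        (𝒮.attach.filter fun S => a ∈ S.1).image
          fun S => ({Sum.inr S} : Finset (β ⊕ {S : Finset β // S ∈ 𝒮}))
    | Sum.inr _ => ∅
  minterm_nonempty := by
    rintro (a | S) s hs
    · simp only [Finset.mem_image] at hs
      obtain ⟨T, -, rfl⟩ := hs
      exact Finset.singleton_nonempty _
    · simp at hs
  minterm_not_self := by
    rintro (a | S) s hs
    · simp only [Finset.mem_image] at hs
      obtain ⟨T, -, rfl⟩ := hs
      simp
    · simp at hs


theorem IIM.cascade_mono_aux_s8 {α : Type*} [Fintype α] [DecidableEq α] (sys : IIM α)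
    (S H : Finset α) : Monotone (sys.cascade S H) := by
  refine monotone_nat_of_le_succ fun t => ?_
  rw [IIM.cascade]
  exact Finset.subset_union_left

theorem setCoverSys_inl_mem {β : Type*} [Fintype β] [DecidableEq β]
    (𝒮 : Finset (Finset β)) (hcov : ∀ x : β, ∃ S ∈ 𝒮, x ∈ S)
    (H : Finset (β ⊕ {S : Finset β // S ∈ 𝒮})) (x : β) (hx : Sum.inl x ∉ H)
    (hn : ∀ S : {S : Finset β // S ∈ 𝒮}, x ∈ S.1 → Sum.inr S ∉ H) :
    Sum.inl x ∈ (setCoverSys β 𝒮).killSetH (𝒮.attach.image fun S => Sum.inr S) H := by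
  obtain ⟨S, hS, hxS⟩ := hcov x
  have hcard : 1 ≤ Fintype.card (β ⊕ {S : Finset β // S ∈ 𝒮}) - 1 := by
    have h1 : 0 < Fintype.card β := Fintype.card_pos_iff.mpr ⟨x⟩
    have h2 : 0 < Fintype.card {S : Finset β // S ∈ 𝒮} := Fintype.card_pos_iff.mpr ⟨⟨S, hS⟩⟩
    rw [Fintype.card_sum]
    omega
  refine IIM.cascade_mono_aux_s8 _ _ _ hcard ?_
  rw [IIM.cascade]
  refine Finset.mem_union_right _ ?_
  simp only [Finset.mem_filter, Finset.mem_univ, true_and]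
  refine ⟨hx, ?_, ?_⟩
  · refine ⟨{Sum.inr ⟨S, hS⟩}, ?_⟩
    exact Finset.mem_image.mpr ⟨⟨S, hS⟩, by simp [hxS], rfl⟩
  · intro s hs
    obtain ⟨T, hT, rfl⟩ := Finset.mem_image.mp hs
    refine ⟨Sum.inr T, ?_, Finset.mem_singleton_self _⟩
    rw [IIM.cascade]
    refine Finset.mem_sdiff.mpr ⟨Finset.mem_image_of_mem _ (Finset.mem_attach _ _), ?_⟩
    exact hn T (Finset.mem_filter.mp hT).2

theorem setCoverSys_cascade_subset {β : Type*} [Fintype β] [DecidableEq β]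
    (𝒮 : Finset (Finset β)) 
    (H : Finset (β ⊕ {S : Finset β // S ∈ 𝒮}))
    (hc : ∀ x : β, ∃ S : {S : Finset β // S ∈ 𝒮}, x ∈ S.1 ∧ Sum.inr S ∈ H) (t : ℕ) :
    (setCoverSys β 𝒮).cascade (𝒮.attach.image fun S => Sum.inr S) H t ⊆
      (𝒮.attach.image fun S => Sum.inr S) \ H := by
  induction t with
  | zero => rw [IIM.cascade]
  | succ t ih =>
    rw [IIM.cascade]
    refine Finset.union_subset ih ?_
    intro e he
    obtain ⟨-, -, hne, hall⟩ := Finset.mem_filter.mp he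
    rcases e with x | T
    · obtain ⟨S, hxS, hSH⟩ := hc x
      obtain ⟨d, hd, hds⟩ := hall {Sum.inr S}
        (Finset.mem_image.mpr ⟨S, by simp [hxS], rfl⟩)
      rw [Finset.mem_singleton] at hds
      subst hds
      exact absurd hSH (Finset.mem_sdiff.mp (ih hd)).2
    · exact absurd hne (Finset.not_nonempty_empty)

/-- Correctness of the reduction from Set Cover to Entity
Hardening under Restricted Case II: with the union of `𝒮` equal to `U` and
initial failure set `E' = {b_S : S ∈ 𝒮}`, for any positive integer
`M ≤ |𝒮|`, there is a hardening set `H` with `|H| ≤ M` and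
`|KillSet_H(E')| ≤ |𝒮| - M` iff at most `M` subsets in `𝒮` have union `U`. -/
theorem setCover_ENH_reduction {β : Type*} [Fintype β] [DecidableEq β]
    (𝒮 : Finset (Finset β)) (hcov : ∀ x : β, ∃ S ∈ 𝒮, x ∈ S)
    (M : ℕ) (hM : 0 < M) (hMm : M ≤ 𝒮.card) :
    (∃ H : Finset (β ⊕ {S : Finset β // S ∈ 𝒮}), H.card ≤ M ∧
      ((setCoverSys β 𝒮).killSetH
        (𝒮.attach.image fun S => Sum.inr S) H).card ≤ 𝒮.card - M) ↔
    (∃ 𝒮' ⊆ 𝒮, 𝒮'.card ≤ M ∧ ∀ x : β, ∃ S ∈ 𝒮', x ∈ S) := by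
  have hE : (𝒮.attach.image fun S =>
      (Sum.inr S : β ⊕ {S : Finset β // S ∈ 𝒮})).card = 𝒮.card := by
    rw [Finset.card_image_of_injective _ Sum.inr_injective, Finset.card_attach]
  constructor
  · rintro ⟨H, hH, hK⟩
    have hinl := setCoverSys_inl_mem 𝒮 hcov H
    have h0 : (𝒮.attach.image fun S => Sum.inr S) \ H ⊆ (setCoverSys β 𝒮).killSetH
        (𝒮.attach.image fun S => Sum.inr S) H := by
      have := IIM.cascade_mono_aux_s8 (setCoverSys β 𝒮) (𝒮.attach.image fun S => Sum.inr S) H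
        (Nat.zero_le (Fintype.card (β ⊕ {S : Finset β // S ∈ 𝒮}) - 1))
      rw [IIM.cascade] at this
      exact this
    generalize (setCoverSys β 𝒮).killSetH (𝒮.attach.image fun S => Sum.inr S) H = K at *
    generalize hB : (𝒮.attach.image fun S =>
      (Sum.inr S : β ⊕ {S : Finset β // S ∈ 𝒮})) = B at *
    have h1 := Finset.card_sdiff_add_card_inter B H
    have h2 := Finset.card_le_card h0
    have h3 : (B ∩ H).card ≤ H.card := Finset.card_le_card Finset.inter_subset_right
    have hBH : B ∩ H = H := Finset.eq_of_subset_of_card_le Finset.inter_subset_right (by omega)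
    have hKe : B \ H = K := Finset.eq_of_subset_of_card_le h0 (by omega)
    have hnB : ∀ x : β, Sum.inl x ∉ B := by
      intro x hx
      rw [← hB] at hx
      simp at hx
    refine ⟨(𝒮.attach.filter fun S => Sum.inr S ∈ H).image Subtype.val, ?_, ?_, ?_⟩
    · intro S hS
      obtain ⟨T, -, rfl⟩ := Finset.mem_image.mp hS
      exact T.2
    · refine Finset.card_image_le.trans (le_trans ?_ hH)
      refine Finset.card_le_card_of_injOn Sum.inr ?_ Sum.inr_injective.injOn
      intro S hS
      exact (Finset.mem_filter.mp hS).2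
    · intro x
      by_contra hcon
      have hx : Sum.inl x ∉ H := fun h => hnB x (Finset.mem_inter.mp (hBH ▸ h)).1
      have := hinl x hx (fun S hxS hS => hcon ⟨S.1, Finset.mem_image.mpr
        ⟨S, Finset.mem_filter.mpr ⟨Finset.mem_attach _ _, hS⟩, rfl⟩, hxS⟩)
      rw [← hKe] at this
      exact hnB x (Finset.mem_sdiff.mp this).1
  · rintro ⟨C, hC, hCM, hCc⟩
    obtain ⟨D, hCD, hD, hDM⟩ := Finset.exists_subsuperset_card_eq hC hCM hMm
    let H : Finset (β ⊕ {S : Finset β // S ∈ 𝒮}) :=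
      (D.subtype (· ∈ 𝒮)).image Sum.inr
    have hHc : H.card = M := by
      rw [Finset.card_image_of_injective _ Sum.inr_injective, Finset.card_subtype,
        Finset.filter_true_of_mem (fun x hx => hD hx), hDM]
    refine ⟨H, hHc.le, ?_⟩
    have hsub := setCoverSys_cascade_subset 𝒮 H (fun x => by
      obtain ⟨S, hS, hxS⟩ := hCc x
      exact ⟨⟨S, hC hS⟩, hxS, Finset.mem_image_of_mem _ (Finset.mem_subtype.mpr (hCD hS))⟩)
      (Fintype.card (β ⊕ {S : Finset β // S ∈ 𝒮}) - 1)
    refine (Finset.card_le_card hsub).trans ?_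
    rw [Finset.card_sdiff_of_subset, hE, hHc]
    intro e he
    obtain ⟨T, -, rfl⟩ := Finset.mem_image.mp he
    exact Finset.mem_image_of_mem _ (Finset.mem_attach _ _)
end

section
/- Hardening entities outside the kill set is useless: in any system with initial failure set E' ⊆ E, if the hardened set H satisfies H ∩ KillSet(E') = ∅, then KillSet_H(E') = KillSet(E'); in particular, no non-hardened entity is protected from failure. -/
open Finset

/-- Hardening entities outside the kill set is useless: if
`H ∩ KillSet(E') = ∅` then `KillSet_H(E') = KillSet(E')`; in particular no
non-hardened entity is protected from failure. -/
theorem harden_outside_killSet_useless {α : Type*} [Fintype α] [DecidableEq α]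
    (sys : IIM α) (E' H : Finset α) (h : H ∩ sys.killSet E' = ∅) :
    sys.killSetH E' H = sys.killSet E' := by
  have mono : Monotone (sys.cascade E' ∅) := by
    refine monotone_nat_of_le_succ fun t => ?_
    rw [IIM.cascade]
    exact Finset.subset_union_left
  have hH : ∀ t ≤ Fintype.card α - 1, ∀ e ∈ sys.cascade E' ∅ t, e ∉ H := by
    intro t ht e he heH
    have hk : e ∈ H ∩ sys.killSet E' := Finset.mem_inter.2 ⟨heH, mono ht he⟩
    rw [h] at hk
    exact Finset.notMem_empty e hk
  have key : ∀ t ≤ Fintype.card α - 1, sys.cascade E' H t = sys.cascade E' ∅ t := by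
    intro t
    induction t with
    | zero =>
      intro ht
      ext e
      have h0 := hH 0 ht e
      simp only [IIM.cascade, Finset.mem_sdiff, Finset.notMem_empty, not_false_eq_true,
        and_true] at h0 ⊢
      tauto
    | succ t ih =>
      intro ht
      ext e
      have h1 := hH (t + 1) ht e
      simp only [IIM.cascade, ih (by omega), Finset.mem_union, Finset.mem_filter,
        Finset.mem_univ, true_and, Finset.notMem_empty, not_false_eq_true] at h1 ⊢
      tauto
  exact key _ le_rfl
end

section
/- Reduction of Entity Hardening under Restricted Case II to Maximum Coverage: in a system satisfying Restricted Case II with initial failure set E' ⊆ E and hardening budget k, the maximum number of entities protected by hardening at most k entities equals the maximum coverage of k protection sets, i.e., max over X ⊆ E with |X| ≤ k of |P(X|E')| equals max over X ⊆ E with |X| ≤ k of |⋃_{e ∈ X} P(e|E')|. -/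
open Finset

namespace IIM

variable {α : Type*} [Fintype α] [DecidableEq α]

theorem mem_cascade_succ (sys : IIM α) (S H : Finset α) (t : ℕ) (e : α) :
    e ∈ sys.cascade S H (t+1) ↔ e ∈ sys.cascade S H t ∨
      (e ∉ H ∧ (sys.idr e).Nonempty ∧ ∀ s ∈ sys.idr e, ∃ d ∈ sys.cascade S H t, d ∈ s) := by
  simp [cascade]

theorem cascade_mono (sys : IIM α) (S H : Finset α) : Monotone (sys.cascade S H) :=
  monotone_nat_of_le_succ fun t e he => (mem_cascade_succ sys S H t e).2 (Or.inl he)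

theorem cascade_stable (sys : IIM α) (S H : Finset α) (t : ℕ)
    (h : sys.cascade S H (t+1) = sys.cascade S H t) :
    sys.cascade S H (t+2) = sys.cascade S H (t+1) := by
  ext e
  rw [mem_cascade_succ sys S H (t+1), mem_cascade_succ sys S H t, h]
  tauto

theorem cascade_card (sys : IIM α) (S H : Finset α) (t : ℕ) :
    sys.cascade S H (t+1) = sys.cascade S H t ∨ t + 2 ≤ (sys.cascade S H (t+1)).card := by
  induction t with
  | zero =>
    by_cases h : sys.cascade S H (0+1) = sys.cascade S H 0
    · exact Or.inl h
    right
    have hss : sys.cascade S H 0 ⊂ sys.cascade S H (0+1) :=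
      (cascade_mono sys S H (Nat.zero_le _)).lt_of_ne (Ne.symm h)
    have hc := Finset.card_lt_card hss
    have hne : (sys.cascade S H 0).Nonempty := by
      by_contra hemp
      rw [Finset.not_nonempty_iff_eq_empty] at hemp
      apply h
      ext e
      rw [mem_cascade_succ, hemp]
      constructor
      · rintro (h | ⟨_, ⟨s, hs⟩, h3⟩)
        · exact h
        · obtain ⟨d, hd, _⟩ := h3 s hs
          exact absurd hd (Finset.notMem_empty _)
      · exact Or.inl
    have := hne.card_pos
    omega
  | succ t ih =>
    rcases ih with ih | ih
    · exact Or.inl (cascade_stable sys S H t ih)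
    by_cases h : sys.cascade S H (t+1+1) = sys.cascade S H (t+1)
    · exact Or.inl h
    right
    have hss : sys.cascade S H (t+1) ⊂ sys.cascade S H (t+1+1) :=
      (cascade_mono sys S H (Nat.le_succ _)).lt_of_ne (Ne.symm h)
    have hc := Finset.card_lt_card hss
    omega

theorem killSetH_closed (sys : IIM α) (S H : Finset α) (e : α) (h1 : e ∉ H)
    (h2 : (sys.idr e).Nonempty) (h3 : ∀ s ∈ sys.idr e, ∃ d ∈ sys.killSetH S H, d ∈ s) :
    e ∈ sys.killSetH S H := by
  have h := (mem_cascade_succ sys S H (Fintype.card α - 1) e).2 (Or.inr ⟨h1, h2, h3⟩)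
  rcases cascade_card sys S H (Fintype.card α - 1) with hc | hc
  · rw [hc] at h
    exact h
  · have := Finset.card_le_univ (sys.cascade S H (Fintype.card α - 1 + 1))
    omega

theorem killSetH_base (sys : IIM α) (S H : Finset α) (e : α) (h1 : e ∈ S) (h2 : e ∉ H) :
    e ∈ sys.killSetH S H :=
  cascade_mono sys S H (Nat.zero_le _) (by simp [cascade, h1, h2])

theorem killSetH_least (sys : IIM α) (S H : Finset α) (C : α → Prop)
    (h0 : ∀ e ∈ S, e ∉ H → C e)
    (h1 : ∀ e, e ∉ H → (sys.idr e).Nonempty → (∀ s ∈ sys.idr e, ∃ d, C d ∧ d ∈ s) → C e)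
    (e : α) (he : e ∈ sys.killSetH S H) : C e := by
  unfold killSetH at he
  generalize Fintype.card α - 1 = t at he
  induction t generalizing e with
  | zero =>
    simp only [cascade, Finset.mem_sdiff] at he
    exact h0 e he.1 he.2
  | succ t ih =>
    rcases (mem_cascade_succ sys S H t e).1 he with h | ⟨ha, hb, hc⟩
    · exact ih e h
    · refine h1 e ha hb fun s hs => ?_
      obtain ⟨d, hd, hds⟩ := hc s hs
      exact ⟨d, ih d hd, hds⟩

theorem killSetH_inv (sys : IIM α) (S H : Finset α) (e : α) (he : e ∈ sys.killSetH S H) :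
    e ∉ H ∧ (e ∈ S ∨ ∀ s ∈ sys.idr e, ∃ d ∈ sys.killSetH S H, d ∈ s) := by
  have := killSetH_least sys S H (fun e => e ∈ sys.killSetH S H ∧
    e ∉ H ∧ (e ∈ S ∨ ∀ s ∈ sys.idr e, ∃ d ∈ sys.killSetH S H, d ∈ s))
    (fun e h1 h2 => ⟨killSetH_base sys S H e h1 h2, h2, Or.inl h1⟩)
    (fun e h1 h2 h3 => by
      have h4 : ∀ s ∈ sys.idr e, ∃ d ∈ sys.killSetH S H, d ∈ s := fun s hs => by
        obtain ⟨d, hd, hds⟩ := h3 s hs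
        exact ⟨d, hd.1, hds⟩
      exact ⟨killSetH_closed sys S H e h1 h2 h4, h1, Or.inr h4⟩) e he
  exact this.2

theorem killSetH_anti (sys : IIM α) (S : Finset α) {H H' : Finset α} (h : H ⊆ H') :
    sys.killSetH S H' ⊆ sys.killSetH S H := fun e he =>
  killSetH_least sys S H' (fun e => e ∈ sys.killSetH S H)
    (fun e h1 h2 => killSetH_base sys S H e h1 (fun h3 => h2 (h h3)))
    (fun e h1 h2 h3 => killSetH_closed sys S H e (fun h4 => h1 (h h4)) h2 h3) e he

theorem protSet_eq_biUnion (sys : IIM α) (hres : sys.RestrictedII) (S X : Finset α) :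
    sys.protSet X S = X.biUnion fun e => sys.protSet {e} S := by
  ext e
  simp only [protSet, Finset.mem_biUnion, Finset.mem_sdiff]
  constructor
  · rintro ⟨h1, h2⟩
    have key := killSetH_least sys S ∅
      (fun e => e ∈ sys.killSetH S X ∨ ∃ x ∈ X, e ∉ sys.killSetH S {x})
    have hX : ∀ e ∈ X, ∃ x ∈ X, e ∉ sys.killSetH S {x} := fun e he =>
      ⟨e, he, fun h => (killSetH_inv sys S {e} e h).1 (Finset.mem_singleton_self e)⟩
    have := key ?_ ?_ e h1
    · rcases this with h | ⟨x, hx, h⟩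
      · exact absurd h h2
      · exact ⟨x, hx, h1, h⟩
    · intro e he _
      by_cases heX : e ∈ X
      · exact Or.inr (hX e heX)
      · exact Or.inl (killSetH_base sys S X e he heX)
    · intro e _ hne hall
      by_cases heX : e ∈ X
      · exact Or.inr (hX e heX)
      by_cases heS : e ∈ S
      · exact Or.inl (killSetH_base sys S X e heS heX)
      by_cases hp : ∀ s ∈ sys.idr e, ∃ d ∈ sys.killSetH S X, d ∈ s
      · exact Or.inl (killSetH_closed sys S X e heX hne hp)
      right
      push Not at hp
      obtain ⟨s, hs, hns⟩ := hp
      obtain ⟨p, hp⟩ := Finset.card_eq_one.1 (hres e s hs)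
      obtain ⟨d, hd, hds⟩ := hall s hs
      rcases hd with hd | ⟨x, hx, hd⟩
      · exact absurd hds (hns d hd)
      refine ⟨x, hx, fun hk => ?_⟩
      rcases (killSetH_inv sys S {x} e hk).2 with h | h
      · exact heS h
      · obtain ⟨d', hd', hds'⟩ := h s hs
        rw [hp, Finset.mem_singleton] at hds hds'
        rw [hds'] at hd'
        rw [hds] at hd
        exact hd hd'
  · rintro ⟨x, hx, h1, h2⟩
    exact ⟨h1, fun h => h2 (killSetH_anti sys S (Finset.singleton_subset_iff.2 hx) h)⟩

end IIM

/-- Reduction of Entity Hardening under Restricted Case II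
to Maximum Coverage: the maximum number of entities protected by hardening at
most `k` entities equals the maximum coverage by `k` of the protection sets. -/
theorem hardening_eq_maxCoverage {α : Type*} [Fintype α] [DecidableEq α]
    (sys : IIM α) (hres : sys.RestrictedII) (E' : Finset α) (k : ℕ) :
    ((Finset.univ.powerset.filter fun X => X.card ≤ k).sup
        fun X => (sys.protSet X E').card) =
    ((Finset.univ.powerset.filter fun X => X.card ≤ k).sup
        fun X => ((X.biUnion fun e => sys.protSet {e} E')).card) := by
  refine Finset.sup_congr rfl fun X _ => ?_
  rw [IIM.protSet_eq_biUnion sys hres E' X]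
end
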